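/- arXiv:2012.14778 — 2 statements merged into one kernel-verified Lean document; each statement's English description precedes it below -/
import Mathlib

section
/- Let S be a positive semifield, X a left S-module with structure map a, and 𝒜 a set of convex subsets of X that is convex with respect to α_a, meaning: for every finitely supported Φ : 𝒫X → S with supp Φ ⊆ 𝒜 and Σ_B Φ(B) = 1, the set α_a(Φ) belongs to 𝒜. Then the union ⋃_{A ∈ 𝒜} A is a convex subset of X. -/
universe u

/-- The structure map of the free `S`-module (semimodule) monad on a left `S`-module `M`:
`a(φ) = Σ_{x ∈ supp φ} φ(x) • x`. -/
noncomputable def structMap (S : Type*) (M : Type*) [Semiring S] [AddCommMonoid M]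
    [Module S M] (φ : M →₀ S) : M :=
  φ.sum fun x s => s • x

/-- The convex closure of a subset `A` of a left `S`-module:
`conv(A) = { a(φ) | φ finitely supported, supp φ ⊆ A, Σ_x φ(x) = 1 }`. -/
def convClos (S : Type*) {M : Type*} [Semiring S] [AddCommMonoid M] [Module S M]
    (A : Set M) : Set M :=
  { m | ∃ φ : M →₀ S, ↑φ.support ⊆ A ∧ (φ.sum fun _ s => s) = 1 ∧ structMap S M φ = m }

/-- A subset of a left `S`-module is convex if it equals its convex closure. -/
def IsConvex (S : Type*) {M : Type*} [Semiring S] [AddCommMonoid M] [Module S M]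
    (A : Set M) : Prop :=
  convClos S A = A

/-- `c(Φ)`: the set of finitely supported functions of the form
`x ↦ Σ_{A ∈ supp Φ, u(A) = x} Φ(A)` for choice functions `u` with `u(A) ∈ A` on `supp Φ`. -/
noncomputable def choiceSet {S : Type*} {X : Type*} [Semiring S] (Φ : Set X →₀ S) :
    Set (X →₀ S) :=
  { φ | ∃ u : Set X → X, (∀ A ∈ Φ.support, u A ∈ A) ∧ φ = Finsupp.mapDomain u Φ }

/-- The canonical weak distributive law `δ_X(Φ) = conv(c(Φ))`,
the convex closure being taken in the module `X →₀ S`. -/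
noncomputable def deltaLaw (S : Type*) {X : Type*} [Semiring S] (Φ : Set X →₀ S) :
    Set (X →₀ S) :=
  convClos S (choiceSet Φ)

/-- `α_a(Φ) = { a(φ) | φ ∈ c(Φ) }`, where `a` is the structure map of the module `M`. -/
noncomputable def alphaMap (S : Type*) {M : Type*} [Semiring S] [AddCommMonoid M]
    [Module S M] (Φ : Set M →₀ S) : Set M :=
  structMap S M '' choiceSet Φ

/-- The Eilenberg–Moore style description of `δ_X(Φ)` via witnesses
`ψ` finitely supported on `{(A, x) | x ∈ A}` such that
`Φ(A) = Σ_{x ∈ A} ψ(A,x)` for all `A` and `φ(x) = Σ_{A ∋ x} ψ(A,x)` for all `x`. -/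
noncomputable def deltaEM (S : Type*) {X : Type*} [Semiring S] (Φ : Set X →₀ S) :
    Set (X →₀ S) :=
  { φ | ∃ ψ : (Set X × X) →₀ S,
      (∀ p ∈ ψ.support, p.2 ∈ p.1) ∧
      Finsupp.mapDomain Prod.fst ψ = Φ ∧
      Finsupp.mapDomain Prod.snd ψ = φ }

/-- The multiplication of the convex-powerset-of-semimodule monad:
`μ(𝒜) = ⋃_{Ω ∈ 𝒜} α(Ω)`. -/
noncomputable def muC (S : Type*) {M : Type*} [Semiring S] [AddCommMonoid M] [Module S M]
    (𝒜 : Set (Set M →₀ S)) : Set M :=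
  ⋃ Ω ∈ 𝒜, alphaMap S Ω

/-- The Kleisli extension `g♯` of `g : Y → C Z`:
`g♯(𝒜) = ⋃_{φ ∈ 𝒜} { Σ_{y ∈ supp φ} φ(y) • ψ_y | ψ_y ∈ g(y) }`. -/
noncomputable def kleisliExt {S : Type*} {Y Z : Type*} [Semiring S]
    (g : Y → Set (Z →₀ S)) (𝒜 : Set (Y →₀ S)) : Set (Z →₀ S) :=
  ⋃ φ ∈ 𝒜, { χ | ∃ ψ : Y → (Z →₀ S), (∀ y ∈ φ.support, ψ y ∈ g y) ∧
      χ = ∑ y ∈ φ.support, φ y • ψ y }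

theorem subset_convClos {S M : Type*} [Semiring S] [AddCommMonoid M] [Module S M] (A : Set M) :
    A ⊆ convClos S A := by
  intro x hx
  refine ⟨Finsupp.single x 1, fun y hy => ?_, by simp, by simp [structMap]⟩
  have := Finsupp.support_single_subset hy
  rw [Finset.mem_singleton] at this
  exact this ▸ hx

theorem sum_smul_mem_convClos {S M : Type*} [Semiring S] [AddCommMonoid M] [Module S M]
    {A : Set M} (t : Finset M) (w : M → S) (ht : ↑t ⊆ A) (hw : ∑ x ∈ t, w x = 1) :
    ∑ x ∈ t, w x • x ∈ convClos S A := by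
  classical
  have hsub : (Finsupp.indicator t fun x _ => w x).support ⊆ t :=
    Finsupp.support_indicator_subset t _
  refine ⟨Finsupp.indicator t fun x _ => w x, fun x hx => ht (hsub hx), ?_, ?_⟩
  · rw [Finsupp.sum_of_support_subset _ hsub _ (by simp), ← hw]
    exact Finset.sum_congr rfl fun x hx => by simp [Finsupp.indicator_of_mem hx]
  · rw [structMap, Finsupp.sum_of_support_subset _ hsub _ (by simp)]
    exact Finset.sum_congr rfl fun x hx => by simp [Finsupp.indicator_of_mem hx]

theorem eq_zero_of_sum_eq_zero_of_zerosumfree {S ι : Type*} [AddCommMonoid S]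
    (hpos : ∀ a b : S, a + b = 0 → a = 0 ∧ b = 0) (t : Finset ι) (w : ι → S)
    (h : ∑ i ∈ t, w i = 0) {i : ι} (hi : i ∈ t) : w i = 0 := by
  classical
  rw [← Finset.add_sum_erase t w hi] at h
  exact (hpos _ _ h).1

theorem mapDomain_apply_eq_sum_filter {S X Y : Type*} [AddCommMonoid S] [DecidableEq Y]
    (f : X → Y) (φ : X →₀ S) (y : Y) :
    Finsupp.mapDomain f φ y = ∑ x ∈ φ.support with f x = y, φ x := by
  rw [Finsupp.mapDomain, Finsupp.sum_apply, Finsupp.sum, Finset.sum_filter]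
  exact Finset.sum_congr rfl fun x _ => Finsupp.single_apply

theorem structMap_mapDomain {S M Y : Type*} [Semiring S] [AddCommMonoid M] [Module S M]
    (u : Y → M) (Φ : Y →₀ S) :
    structMap S M (Finsupp.mapDomain u Φ) = Φ.sum fun y s => s • u y :=
  Finsupp.sum_mapDomain_index (by simp) (by simp [add_smul])

/-- if `𝒜` is a set of convex subsets of `X` that is convex with respect
to `α_a`, then `⋃ 𝒜` is convex. -/
theorem sUnion_convex_of_alphaMap_convex {S : Type*} [DivisionSemiring S]
    (hpos : ∀ a b : S, a + b = 0 → a = 0 ∧ b = 0)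
    {X : Type u} [AddCommMonoid X] [Module S X]
    (𝒜 : Set (Set X)) (hconv : ∀ A ∈ 𝒜, IsConvex S A)
    (hclosed : ∀ Φ : Set X →₀ S, ↑Φ.support ⊆ 𝒜 → (Φ.sum fun _ s => s) = 1 →
        alphaMap S Φ ∈ 𝒜) :
    IsConvex S (⋃₀ 𝒜) := by
  classical
  refine Set.Subset.antisymm ?_ (subset_convClos _)
  rintro _ ⟨φ, hφ, hsum, rfl⟩
  have hcover : ∀ x, ∃ A : Set X, x ∈ φ.support → A ∈ 𝒜 ∧ x ∈ A := by
    intro x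
    by_cases hx : x ∈ φ.support
    · obtain ⟨A, hA, hxA⟩ := hφ hx
      exact ⟨A, fun _ => ⟨hA, hxA⟩⟩
    · exact ⟨∅, fun h => absurd h hx⟩
  choose f hf using hcover
  set Φ : Set X →₀ S := Finsupp.mapDomain f φ with hΦ
  have hsupp : Φ.support ⊆ φ.support.image f := Finsupp.mapDomain_support
  have hΦ𝒜 : ↑Φ.support ⊆ 𝒜 := by
    intro B hB
    obtain ⟨x, hx, rfl⟩ := Finset.mem_image.1 (hsupp hB)
    exact (hf x hx).1
  have hΦsum : (Φ.sum fun _ s => s) = 1 := by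
    rw [hΦ, Finsupp.sum_mapDomain_index (by simp) (by simp), hsum]
  let u : Set X → X := fun B => ∑ x ∈ φ.support with f x = B, ((Φ B)⁻¹ * φ x) • x
  have hu : ∀ B ∈ Φ.support, u B ∈ B := by
    intro B hB
    have hmem : u B ∈ convClos S B := by
      refine sum_smul_mem_convClos _ _ ?_ ?_
      · intro x hx
        obtain ⟨hxφ, rfl⟩ := Finset.mem_filter.1 hx
        exact (hf x hxφ).2
      · rw [← Finset.mul_sum, ← mapDomain_apply_eq_sum_filter]
        exact inv_mul_cancel₀ (Finsupp.mem_support_iff.1 hB)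
    rwa [hconv B (hΦ𝒜 hB)] at hmem
  refine ⟨alphaMap S Φ, hclosed Φ hΦ𝒜 hΦsum, Finsupp.mapDomain u Φ, ⟨u, hu, rfl⟩, ?_⟩
  rw [structMap_mapDomain, Finsupp.sum_of_support_subset _ hsupp _ (by simp), structMap,
    Finsupp.sum,
    ← Finset.sum_fiberwise_of_maps_to (fun x hx => Finset.mem_image_of_mem f hx)]
  refine Finset.sum_congr rfl fun B hB => ?_
  have hB0 : Φ B ≠ 0 := by
    intro h
    obtain ⟨x, hx, rfl⟩ := Finset.mem_image.1 hB
    rw [hΦ, mapDomain_apply_eq_sum_filter] at h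
    exact Finsupp.mem_support_iff.1 hx
      (eq_zero_of_sum_eq_zero_of_zerosumfree hpos _ _ h (by simpa using hx))
  simp only [u, Finset.smul_sum, smul_smul, mul_inv_cancel_left₀ hB0]
end

section
/- Let S be a positive semifield and (X, a, b) a δ-algebra. Then for every A ⊆ X, b(A) = b(conv(A)). -/
universe u

theorem structMap_eq_linearCombination {S M : Type*} [Semiring S] [AddCommMonoid M]
    [Module S M] (φ : M →₀ S) : structMap S M φ = Finsupp.linearCombination S id φ :=
  rfl

theorem structMap_mapDomain_s11 {S M N : Type*} [Semiring S] [AddCommMonoid M] [Module S M]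
    [AddCommMonoid N] [Module S N] (f : M →ₗ[S] N) (φ : M →₀ S) :
    structMap S N (Finsupp.mapDomain f φ) = f (structMap S M φ) := by
  rw [structMap_eq_linearCombination, structMap_eq_linearCombination,
    Finsupp.linearCombination_mapDomain, Finsupp.apply_linearCombination]
  rfl

theorem sum_mapDomain_self {S α β : Type*} [Semiring S] (f : α → β) (φ : α →₀ S) :
    ((Finsupp.mapDomain f φ).sum fun _ s => s) = φ.sum fun _ s => s :=
  Finsupp.sum_mapDomain_index (fun _ => rfl) fun _ _ _ => rfl

/-- Linear maps commute with the convex closure. -/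
theorem image_convClos {S M N : Type*} [Semiring S] [AddCommMonoid M] [Module S M]
    [AddCommMonoid N] [Module S N] (f : M →ₗ[S] N) (A : Set M) :
    f '' convClos S A = convClos S (f '' A) := by
  classical
  ext n
  constructor
  · rintro ⟨_, ⟨φ, hφ, hsum, rfl⟩, rfl⟩
    refine ⟨Finsupp.mapDomain f φ, fun y hy => ?_, (sum_mapDomain_self f φ).trans hsum,
      structMap_mapDomain_s11 f φ⟩
    obtain ⟨x, hx, rfl⟩ := Finset.mem_image.1 (Finsupp.mapDomain_support hy)
    exact ⟨x, hφ hx, rfl⟩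
  · rintro ⟨φ, hφ, hsum, rfl⟩
    have hex : ∀ y : N, ∃ x : M, y ∈ f '' A → x ∈ A ∧ f x = y := fun y => by
      by_cases hy : y ∈ f '' A
      · obtain ⟨x, hx⟩ := hy
        exact ⟨x, fun _ => hx⟩
      · exact ⟨0, fun h => absurd h hy⟩
    choose g hg using hex
    refine ⟨_, ⟨Finsupp.mapDomain g φ, fun x hx => ?_,
      (sum_mapDomain_self g φ).trans hsum, rfl⟩, ?_⟩
    · obtain ⟨y, hy, rfl⟩ := Finset.mem_image.1 (Finsupp.mapDomain_support hx)
      exact (hg y (hφ hy)).1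
    · rw [← structMap_mapDomain_s11, ← Finsupp.mapDomain_comp]
      congr 1
      refine (Finsupp.mapDomain_congr fun y hy => ?_).trans Finsupp.mapDomain_id
      exact (hg y (hφ hy)).2

theorem structMap_single_one {S M : Type*} [Semiring S] [AddCommMonoid M] [Module S M]
    (x : M) : structMap S M (Finsupp.single x 1) = x := by
  simp [structMap]

theorem choiceSet_single_one {S X : Type*} [Semiring S] [Nontrivial S] (A : Set X) :
    choiceSet (Finsupp.single A (1 : S)) = (fun x => Finsupp.single x 1) '' A := by
  ext φ
  constructor
  · rintro ⟨u, hu, rfl⟩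
    exact ⟨u A, hu A (by simp), Finsupp.mapDomain_single.symm⟩
  · rintro ⟨x, hx, rfl⟩
    refine ⟨fun _ => x, fun B hB => ?_, by simp only [Finsupp.mapDomain_single]⟩
    obtain rfl : B = A := by
      simpa using Finsupp.support_single_subset hB
    exact hx

theorem image_deltaLaw_single_one {S M : Type*} [Semiring S] [Nontrivial S]
    [AddCommMonoid M] [Module S M] (A : Set M) :
    structMap S M '' deltaLaw S (Finsupp.single A (1 : S)) = convClos S A := by
  have h := image_convClos (Finsupp.linearCombination S (id : M → M))
    (choiceSet (Finsupp.single A (1 : S)))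
  refine h.trans ?_
  rw [choiceSet_single_one, Set.image_image]
  simp

/-- in any `δ`-algebra `(X, a, b)` over a positive semifield,
`b(A) = b(conv(A))` for all `A ⊆ X`. -/
theorem deltaAlgebra_b_convClos {S : Type*} [DivisionSemiring S]
    (hpos : ∀ a b : S, a + b = 0 → a = 0 ∧ b = 0)
    {X : Type u} [AddCommMonoid X] [Module S X]
    (b : Set X → X)
    (hb1 : ∀ x : X, b {x} = x)
    (hb2 : ∀ 𝒰 : Set (Set X), b (b '' 𝒰) = b (⋃₀ 𝒰))
    (hb3 : ∀ Φ : Set X →₀ S,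
        structMap S X (Finsupp.mapDomain b Φ) = b (structMap S X '' deltaLaw S Φ))
    (A : Set X) :
    b A = b (convClos S A) := by
  rw [← image_deltaLaw_single_one A, ← hb3, Finsupp.mapDomain_single, structMap_single_one]
end
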